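/- arXiv:1811.11035 — 4 statements merged into one kernel-verified Lean document; each statement's English description precedes it below -/
import Mathlib

section
/- For every k ∈ {5, 6, 7} and every real number p with 0 ≤ p ≤ 1, the inequality −(1−p) − p³ + (k−3)·p·(1−p)² ≤ −0.087 holds. -/
theorem stmt_3 (k : ℕ) (hk : k ∈ ({5, 6, 7} : Set ℕ)) (p : ℝ) (hp0 : 0 ≤ p) (hp1 : p ≤ 1) :
    -(1 - p) - p ^ 3 + ((k : ℝ) - 3) * p * (1 - p) ^ 2 ≤ -0.087 := by
  have h7 : -(1 - p) - p ^ 3 + 4 * (p * (1 - p) ^ 2) ≤ -0.087 := by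
    have h : 0 ≤ (p - 0.4046) ^ 2 * (5.5724 - 3 * p) :=
      mul_nonneg (sq_nonneg _) (by linarith)
    nlinarith [h]
  have hk7 : (k : ℝ) ≤ 7 := by
    rcases hk with rfl | rfl | rfl <;> norm_num
  have hq : 0 ≤ p * (1 - p) ^ 2 := mul_nonneg hp0 (sq_nonneg _)
  nlinarith [mul_nonneg (sub_nonneg.2 hk7) hq]
end

section
/- For every integer k ≥ 8 and every real number p with 0 ≤ p ≤ 1/(k−2), the inequality −(1−p) − p³ + (k−3)·p·(1−p)² ≤ −((k−3)·(k−2)² − (k−3)³ + 1)/(k−2)³ holds; moreover the right-hand side −((k−3)·(k−2)² − (k−3)³ + 1)/(k−2)³ is negative. -/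
theorem stmt_4 (k : ℕ) (hk : 8 ≤ k) (p : ℝ) (hp0 : 0 ≤ p) (hp1 : p ≤ 1 / ((k : ℝ) - 2)) :
    -(1 - p) - p ^ 3 + ((k : ℝ) - 3) * p * (1 - p) ^ 2 ≤
      -((((k : ℝ) - 3) * ((k : ℝ) - 2) ^ 2 - ((k : ℝ) - 3) ^ 3 + 1) / ((k : ℝ) - 2) ^ 3) ∧
    -((((k : ℝ) - 3) * ((k : ℝ) - 2) ^ 2 - ((k : ℝ) - 3) ^ 3 + 1) / ((k : ℝ) - 2) ^ 3) < 0 := by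
  have hk' : (8 : ℝ) ≤ k := by exact_mod_cast hk
  obtain ⟨m, hm⟩ : ∃ m : ℝ, m = (k : ℝ) - 2 := ⟨_, rfl⟩
  have h3 : (k : ℝ) - 3 = m - 1 := by rw [hm]; ring
  rw [h3, ← hm]
  rw [← hm] at hp1
  have hm6 : 6 ≤ m := by linarith
  have hm0 : 0 < m := by linarith
  constructor
  · obtain ⟨q, hq⟩ : ∃ q : ℝ, q = 1 / m := ⟨_, rfl⟩
    rw [← hq] at hp1
    have hq6 : q ≤ 1 / 6 := by
      rw [hq]; exact one_div_le_one_div_of_le (by norm_num) hm6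
    have e : -(((m - 1) * m ^ 2 - (m - 1) ^ 3 + 1) / m ^ 3)
        = -(1 - q) - q ^ 3 + (m - 1) * q * (1 - q) ^ 2 := by
      rw [hq]; field_simp; ring
    rw [e]
    have hS : 0 ≤ p ^ 2 + p * q + q ^ 2 := by
      have : 0 ≤ q := hp0.trans hp1
      positivity
    have h1 : 0 ≤ (m - 2) * (p ^ 2 + p * q + q ^ 2) := mul_nonneg (by linarith) hS
    have h2 : 0 ≤ (m - 1) * (1 - 2 * (p + q)) := mul_nonneg (by linarith) (by linarith)
    have h4 : 0 ≤ (q - p) * (1 + (m - 2) * (p ^ 2 + p * q + q ^ 2)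
        + (m - 1) * (1 - 2 * (p + q))) := mul_nonneg (by linarith) (by linarith)
    linarith
  · rw [neg_lt_zero]
    have h5 : 0 < (m - 1) * (2 * m - 1) := mul_pos (by linarith) (by linarith)
    exact div_pos (by linarith) (by positivity)
end

section
/- For every k ∈ {5, 6, 7} and every real number p with 0 ≤ p ≤ 1, the inequality −(1−p) − p³ + (k−4)·p·(1−p)² ≤ −0.2 holds. -/
theorem stmt_5 (k : ℕ) (hk : k ∈ ({5, 6, 7} : Set ℕ)) (p : ℝ) (hp0 : 0 ≤ p) (hp1 : p ≤ 1) :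
    -(1 - p) - p ^ 3 + ((k : ℝ) - 4) * p * (1 - p) ^ 2 ≤ -0.2 := by
  have hk7 : (k : ℝ) ≤ 7 := by
    have : k ≤ 7 := by
      simp only [Set.mem_insert_iff, Set.mem_singleton_iff] at hk
      omega
    exact_mod_cast this
  have h1 : 0 ≤ (7 - (k : ℝ)) * (p * (1 - p) ^ 2) :=
    mul_nonneg (by linarith) (mul_nonneg hp0 (sq_nonneg _))
  have h2 : 0 ≤ (1 - p) * (p - 0.42) ^ 2 := mul_nonneg (by linarith) (sq_nonneg _)
  have h3 : 0 ≤ (p - 0.424) ^ 2 := sq_nonneg _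
  norm_num at h2 h3 ⊢
  nlinarith [h1, h2, h3]
end

section
/- For every k ∈ {5, 6, 7} and all real numbers p, q ≥ 0 with p + q ≤ 1, the inequality k·(−(1−p) − q − p³ + (k−4)·p·(1−p)²) + 4.8·q·(1+2p) ≤ −391/1960 holds. -/
/-- An affine function on `[0, r]` is bounded by its endpoint values. -/
lemma affine_le (A B q r c : ℝ) (hq : 0 ≤ q) (hr : q ≤ r) (h0 : A ≤ c) (h1 : A + r * B ≤ c) :
    A + q * B ≤ c := by
  rcases le_total 0 B with h | h
  · have := mul_le_mul_of_nonneg_right hr h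
    linarith
  · have := mul_nonpos_of_nonneg_of_nonpos hq h
    linarith

theorem stmt_6 (k : ℕ) (hk : k ∈ ({5, 6, 7} : Set ℕ)) (p q : ℝ)
    (hp : 0 ≤ p) (hq : 0 ≤ q) (hpq : p + q ≤ 1) :
    (k : ℝ) * (-(1 - p) - q - p ^ 3 + ((k : ℝ) - 4) * p * (1 - p) ^ 2) + 4.8 * q * (1 + 2 * p) ≤
      -391 / 1960 := by
  have hp1 : 0 ≤ 1 - p := by linarith
  have key := affine_le ((k : ℝ) * (-(1 - p) - p ^ 3 + ((k : ℝ) - 4) * p * (1 - p) ^ 2))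
    (-(k : ℝ) + 4.8 * (1 + 2 * p)) q (1 - p) (-391 / 1960) hq (by linarith)
  refine le_trans (le_of_eq (by ring)) (key ?_ ?_)
  · rcases hk with rfl | rfl | rfl <;> push_cast
    · nlinarith [sq_nonneg (p - 1 / 2)]
    · nlinarith [sq_nonneg (p - 0.451), mul_nonneg hp (sq_nonneg (p - 0.451))]
    · nlinarith [sq_nonneg (p - 0.423), mul_nonneg hp (sq_nonneg (p - 0.423)),
        mul_nonneg hp1 (sq_nonneg (p - 0.423))]
  · rcases hk with rfl | rfl | rfl <;> push_cast
    · nlinarith [sq_nonneg (p - 99 / 196)]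
    · nlinarith [sq_nonneg (p - 0.494), mul_nonneg hp (sq_nonneg (p - 0.494)),
        mul_nonneg hp1 (sq_nonneg (p - 0.494))]
    · nlinarith [sq_nonneg (p - 0.479), mul_nonneg hp (sq_nonneg (p - 0.479)),
        mul_nonneg hp1 (sq_nonneg (p - 0.479))]
end
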